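/- arXiv:2103.11569 — 2 statements merged into one kernel-verified Lean document; each statement's English description precedes it below -/
import Mathlib

section
/- Let γ > 0, let A_c be a real n×n matrix, B a real n×q matrix, and C_c a real p×n matrix, and assume the pair (C_c, A_c) is observable in the PBH sense. Then the following are equivalent: (i) A_c is Hurwitz, and for every ω ∈ ℝ the complex matrix (iω)·I − A_c is invertible and for every v ∈ ℂ^q, ‖C_c·((iω)·I − A_c)⁻¹·B·v‖ ≤ γ·‖v‖ in the Euclidean norm; (ii) there exists a real symmetric positive definite n×n matrix P such that the Riccati inequality A_cᵀ·P + P·A_c + γ⁻²·P·B·Bᵀ·P + C_cᵀ·C_c ⪯ 0 holds (i.e., the left-hand side is negative semidefinite). -/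
open Matrix

/-- Euclidean norm of a complex vector. -/
noncomputable def euclNorm {ι : Type*} [Fintype ι] (x : ι → ℂ) : ℝ :=
  ‖(WithLp.equiv 2 (ι → ℂ)).symm x‖

/-- A real square matrix is Hurwitz if every eigenvalue (as a complex matrix)
has strictly negative real part. -/
def IsHurwitz {ι : Type*} [Fintype ι] [DecidableEq ι] (M : Matrix ι ι ℝ) : Prop :=
  ∀ lam ∈ spectrum ℂ (M.map (algebraMap ℝ ℂ)), lam.re < 0

/-- PBH observability test for the pair (Cm, Am). -/
def PBHObservable {κ ι : Type*} [Fintype κ] [Fintype ι]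
    (Cm : Matrix κ ι ℝ) (Am : Matrix ι ι ℝ) : Prop :=
  ∀ (lam : ℂ) (v : ι → ℂ), v ≠ 0 →
    (Am.map (algebraMap ℝ ℂ)) *ᵥ v = lam • v →
    (Cm.map (algebraMap ℝ ℂ)) *ᵥ v ≠ 0

open Filter Topology
open scoped InnerProductSpace ComplexConjugate

section
variable {E : Type*} [NormedAddCommGroup E] [InnerProductSpace ℂ E] [FiniteDimensional ℂ E]

/-- All eigenvalues of `A` lie in the open left half-plane. -/
def StableOp (A : E →L[ℂ] E) : Prop :=
  ∀ (μ : ℂ) (x : E), x ≠ 0 → A x = μ • x → μ.re < 0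

theorem ContinuousLinearMap.isUnit_of_forall_eq_zero (T : E →L[ℂ] E)
    (h : ∀ x, T x = 0 → x = 0) : IsUnit T := by
  rw [ContinuousLinearMap.isUnit_iff_bijective]
  have hi : Function.Injective T := (injective_iff_map_eq_zero T).2 h
  exact ⟨hi, (LinearMap.injective_iff_surjective (f := (T : E →ₗ[ℂ] E))).1 hi⟩

theorem ContinuousLinearMap.exists_eigenvector_of_mem_spectrum (T : E →L[ℂ] E) {μ : ℂ}
    (h : μ ∈ spectrum ℂ T) : ∃ x, x ≠ 0 ∧ T x = μ • x := by
  by_contra! hc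
  refine h (isUnit_of_forall_eq_zero _ fun x hx => ?_)
  by_contra hx0
  refine hc x hx0 ?_
  rw [_root_.sub_apply, sub_eq_zero] at hx
  rw [← hx]
  simp [Algebra.algebraMap_eq_smul_one]

theorem tendsto_pow_zero_of_spectralRadius_lt_one {R : Type*} [NormedRing R] [NormedAlgebra ℂ R]
    [CompleteSpace R] {T : R} (h : spectralRadius ℂ T < 1) :
    Tendsto (fun k : ℕ => T ^ k) atTop (𝓝 0) := by
  obtain ⟨c, hc, hc1⟩ := ENNReal.lt_iff_exists_nnreal_btwn.1 h
  have hc1' : c < 1 := by exact_mod_cast hc1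
  have h1 := (spectrum.pow_nnnorm_pow_one_div_tendsto_nhds_spectralRadius T).eventually_lt_const hc
  refine squeeze_zero_norm' (a := fun k : ℕ => (c : ℝ) ^ k) ?_
    (tendsto_pow_atTop_nhds_zero_of_lt_one c.2 (by exact_mod_cast hc1'))
  filter_upwards [h1, eventually_gt_atTop 0] with k hk hk0
  have hk0' : (0 : ℝ) < k := by exact_mod_cast hk0
  have h2 := ENNReal.rpow_le_rpow hk.le hk0'.le
  rw [← ENNReal.rpow_mul, one_div_mul_cancel hk0'.ne', ENNReal.rpow_one, ENNReal.rpow_natCast] at h2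
  exact_mod_cast h2

/-- Lyapunov: a quadratic form that is nonincreasing along a stable linear flow is nonnegative. -/
theorem StableOp.re_inner_nonneg {A P : E →L[ℂ] E} (hA : StableOp A) (hP : IsSelfAdjoint P)
    (h : ∀ x, (⟪P x, A x⟫_ℂ).re ≤ 0) (x : E) : 0 ≤ (⟪P x, x⟫_ℂ).re := by
  rcases subsingleton_or_nontrivial E with hE | hE
  · simp [Subsingleton.elim x 0]
  have hsym : ∀ x y, ⟪P x, y⟫_ℂ = ⟪x, P y⟫_ℂ := hP.isSymmetric
  have hunit : IsUnit (1 - A) := by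
    refine ContinuousLinearMap.isUnit_of_forall_eq_zero _ fun x hx => ?_
    by_contra hx0
    have := hA 1 x hx0 (by
      rw [one_smul]; exact (sub_eq_zero.1 (by simpa using hx)).symm)
    norm_num at this
  obtain ⟨U, hU⟩ := hunit
  let R : E →L[ℂ] E := (↑U⁻¹ : E →L[ℂ] E)
  have hR : ∀ x, R x - A (R x) = x := fun x => by
    have : ((U : E →L[ℂ] E) * R) x = x := by simp [R]
    rw [hU] at this
    simpa using this
  let T : E →L[ℂ] E := (1 + A) * R
  have hT : ∀ x, T x = R x + A (R x) := fun x => by simp [T]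
  have hrad : spectralRadius ℂ T < 1 := by
    refine spectrum.spectralRadius_lt_of_forall_lt _ (r := 1) fun μ hμ => ?_
    obtain ⟨x, hx0, hx⟩ := T.exists_eigenvector_of_mem_spectrum hμ
    rw [hT] at hx
    set y := R x with hy
    have hyx : y - A y = x := hR x
    have hy0 : y ≠ 0 := by
      rintro h0
      rw [h0] at hyx
      simp at hyx
      exact hx0 hyx.symm
    have h1 : (1 + μ) • A y = (μ - 1) • y := by
      rw [← hyx] at hx
      linear_combination (norm := module) hx
    have hμ1 : 1 + μ ≠ 0 := by
      intro h0
      rw [h0, zero_smul] at h1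
      have : μ - 1 = 0 := by
        rcases smul_eq_zero.1 h1.symm with h | h
        · exact h
        · exact absurd h hy0
      have h2 : (2 : ℂ) = 0 := by linear_combination h0 - this
      norm_num at h2
    have h2 := hA ((μ - 1) / (1 + μ)) y hy0 (by
      rw [div_eq_inv_mul, mul_smul, ← h1, smul_smul, inv_mul_cancel₀ hμ1, one_smul])
    rw [Complex.div_re, ← add_div, div_neg_iff] at h2
    have h3 : 0 ≤ Complex.normSq (1 + μ) := Complex.normSq_nonneg _
    have h4 : Complex.normSq μ < 1 := by
      rw [Complex.normSq_apply]
      rcases h2 with h2 | h2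
      · linarith [h2.2]
      · have := h2.1
        simp at this
        nlinarith
    rw [Complex.normSq_eq_norm_sq] at h4
    have : ‖μ‖ < 1 := by nlinarith [norm_nonneg μ]
    exact_mod_cast this
  have hlim := tendsto_pow_zero_of_spectralRadius_lt_one hrad
  have hdec : ∀ x, (⟪P (T x), T x⟫_ℂ).re ≤ (⟪P x, x⟫_ℂ).re := fun x => by
    have h1 := h (R x)
    have h2 : (⟪P (A (R x)), R x⟫_ℂ).re = (⟪P (R x), A (R x)⟫_ℂ).re := by
      rw [hsym, ← inner_conj_symm, Complex.conj_re]
    have h3 : ⟪P x, x⟫_ℂ = ⟪P (R x - A (R x)), R x - A (R x)⟫_ℂ := by rw [hR]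
    rw [h3, hT]
    simp only [map_add, map_sub, inner_add_left, inner_add_right, inner_sub_left, inner_sub_right,
      Complex.add_re, Complex.sub_re]
    linarith
  have hdec' : ∀ k : ℕ, (⟪P ((T ^ k) x), (T ^ k) x⟫_ℂ).re ≤ (⟪P x, x⟫_ℂ).re := fun k => by
    induction k with
    | zero => simp
    | succ k ih =>
      rw [pow_succ']
      exact (hdec _).trans ih
  have hc : Continuous fun S : E →L[ℂ] E => (⟪P (S x), S x⟫_ℂ).re := by fun_prop
  have := (hc.tendsto 0).comp hlim
  simp only [_root_.zero_apply, map_zero, inner_zero_left, Complex.zero_re] at this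
  exact le_of_tendsto this (Eventually.of_forall hdec')

theorem map_ker_of_re_inner_nonpos {A P : E →L[ℂ] E} (hP : IsSelfAdjoint P)
    (h : ∀ x, (⟪P x, A x⟫_ℂ).re ≤ 0) {x : E} (hx : P x = 0) : P (A x) = 0 := by
  set y := P (A x)
  have hy : (⟪P y, A x⟫_ℂ).re = ‖y‖ ^ 2 := by
    rw [show ⟪P y, A x⟫_ℂ = ⟪y, P (A x)⟫_ℂ from hP.isSymmetric y (A x)]
    exact inner_self_eq_norm_sq (𝕜 := ℂ) y
  have key : ∀ t : ℝ, t * ‖y‖ ^ 2 + t ^ 2 * (⟪P y, A y⟫_ℂ).re ≤ 0 := fun t => by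
    have := h (x + (t : ℂ) • y)
    simp only [map_add, map_smul, hx, zero_add, inner_add_right, inner_smul_left, inner_smul_right,
      Complex.add_re, Complex.conj_ofReal, Complex.re_ofReal_mul, hy] at this
    linarith
  set c := (⟪P y, A y⟫_ℂ).re
  have h0 : ‖y‖ ^ 2 ≤ 0 := by
    have hpos : 0 < 1 + |c| := by positivity
    have := key (‖y‖ ^ 2 / (1 + |c|))
    set s := ‖y‖ ^ 2 / (1 + |c|) with hs
    have hy2 : ‖y‖ ^ 2 = s * (1 + |c|) := by rw [hs]; field_simp
    rw [hy2] at this ⊢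
    have h1 : s = 0 := by nlinarith [neg_abs_le c, sq_nonneg s]
    simp [h1]
  simpa using h0

end

section
variable {H : Type*} [NormedAddCommGroup H] [InnerProductSpace ℂ H]

theorem LinearIsometry.norm_eq_one_of_eigenvector (W : H →ₗᵢ[ℂ] H) {θ : ℂ} {x : H} (hx : x ≠ 0)
    (h : W x = θ • x) : ‖θ‖ = 1 := by
  have h1 : ‖x‖ = ‖θ‖ * ‖x‖ := by rw [← norm_smul, ← h, W.norm_map]
  have h2 : ‖x‖ ≠ 0 := norm_ne_zero_iff.2 hx
  exact (mul_right_cancel₀ h2 (by rw [one_mul]; exact h1)).symm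

theorem LinearIsometry.orthogonalFamily_eigenspaces (W : H →ₗᵢ[ℂ] H) :
    OrthogonalFamily ℂ (fun μ => Module.End.eigenspace W.toLinearMap μ)
      fun μ => (Module.End.eigenspace W.toLinearMap μ).subtypeₗᵢ := by
  rintro μ ν hμν ⟨v, hv⟩ ⟨w, hw⟩
  have hv' : W v = μ • v := Module.End.mem_eigenspace_iff.1 hv
  have hw' : W w = ν • w := Module.End.mem_eigenspace_iff.1 hw
  change ⟪v, w⟫_ℂ = 0
  by_contra h0
  have hv0 : v ≠ 0 := by rintro rfl; simp at h0
  have hμ := W.norm_eq_one_of_eigenvector hv0 hv'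
  have h1 : ⟪v, w⟫_ℂ = conj μ * ν * ⟪v, w⟫_ℂ := by
    conv_lhs => rw [← W.inner_map_map, hv', hw', inner_smul_left, inner_smul_right]
    ring
  have h2 : conj μ * ν = 1 := mul_right_cancel₀ h0 (by rw [one_mul]; exact h1.symm)
  have h3 : μ * conj μ = 1 := by rw [Complex.mul_conj, Complex.normSq_eq_norm_sq, hμ]; norm_num
  exact hμν (by linear_combination ν * h3 - μ * h2)

variable [FiniteDimensional ℂ H]

theorem LinearIsometry.orthogonal_iSup_eigenspaces (W : H →ₗᵢ[ℂ] H) :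
    (⨆ μ, Module.End.eigenspace W.toLinearMap μ)ᗮ = ⊥ := by
  by_contra hN
  set N := (⨆ μ, Module.End.eigenspace W.toLinearMap μ)ᗮ with hNdef
  have hmem : ∀ x, x ∈ N ↔ ∀ (μ : ℂ) (v : H), W v = μ • v → ⟪v, x⟫_ℂ = 0 := fun x => by
    rw [hNdef, ← Submodule.iInf_orthogonal, Submodule.mem_iInf]
    refine forall_congr' fun μ => ?_
    rw [Submodule.mem_orthogonal]
    exact forall_congr' fun v => by rw [Module.End.mem_eigenspace_iff]; rfl
  have hinv : ∀ x ∈ N, W.toLinearMap x ∈ N := fun x hx => by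
    rw [hmem] at hx ⊢
    intro μ v hv
    by_cases hv0 : v = 0
    · simp [hv0]
    have h1 : ⟪W v, W x⟫_ℂ = 0 := by rw [W.inner_map_map]; exact hx μ v hv
    rw [hv, inner_smul_left] at h1
    refine (mul_eq_zero.1 h1).resolve_left fun h => ?_
    have h2 := W.norm_eq_one_of_eigenvector hv0 hv
    rw [(map_eq_zero _).1 h] at h2
    simp at h2
  have : Nontrivial N := Submodule.nontrivial_iff_ne_bot.2 hN
  obtain ⟨μ, hμ⟩ := Module.End.exists_eigenvalue (W.toLinearMap.restrict hinv)
  obtain ⟨⟨v, hvN⟩, hv⟩ := hμ.exists_hasEigenvector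
  have h1 : W v = μ • v := congrArg Subtype.val hv.apply_eq_smul
  have h2 := (hmem v).1 hvN μ v h1
  exact hv.2 (by simpa using h2)

theorem LinearIsometry.exists_orthonormalBasis_eigenvectors (W : H →ₗᵢ[ℂ] H) :
    ∃ b : OrthonormalBasis (Fin (Module.finrank ℂ H)) ℂ H, ∀ i, ∃ θ : ℂ, W (b i) = θ • b i := by
  have hof := W.orthogonalFamily_eigenspaces.comp
    (γ := Module.End.Eigenvalues W.toLinearMap) (f := fun μ => (μ : ℂ)) Subtype.coe_injective
  have hint : DirectSum.IsInternal
      fun μ : Module.End.Eigenvalues W.toLinearMap =>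
        Module.End.eigenspace W.toLinearMap (μ : ℂ) := by
    rw [hof.isInternal_iff]
    rw [← W.orthogonal_iSup_eigenspaces]
    congr 1
    refine le_antisymm (iSup_le fun μ => le_iSup (fun μ => Module.End.eigenspace W.toLinearMap μ) _)
      (iSup_le fun μ => ?_)
    by_cases h : Module.End.HasEigenvalue W.toLinearMap μ
    · exact le_iSup (fun μ : Module.End.Eigenvalues W.toLinearMap =>
        Module.End.eigenspace W.toLinearMap (μ : ℂ)) ⟨μ, h⟩
    · rw [Module.End.hasEigenvalue_iff, not_not] at h
      simp [h]
  exact ⟨hint.subordinateOrthonormalBasis rfl hof, fun i => ⟨_, Module.End.mem_eigenspace_iff.1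
    (hint.subordinateOrthonormalBasis_subordinate rfl i hof)⟩⟩

theorem OrthonormalBasis.sum_sq_norm_map {ι G : Type*} [Fintype ι]
    [NormedAddCommGroup G] [InnerProductSpace ℂ G] [FiniteDimensional ℂ G]
    (b : OrthonormalBasis ι ℂ H) (T : H →ₗ[ℂ] G) :
    ((∑ i, ‖T (b i)‖ ^ 2 : ℝ) : ℂ) = LinearMap.trace ℂ H (T.adjoint ∘ₗ T) := by
  rw [LinearMap.trace_eq_sum_inner _ b]
  push_cast
  refine Finset.sum_congr rfl fun i _ => ?_
  rw [Function.comp_apply, LinearMap.adjoint_inner_right, inner_self_eq_norm_sq_to_K]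
  rfl

theorem OrthonormalBasis.sum_sq_norm_map_eq {ι κ G : Type*} [Fintype ι] [Fintype κ]
    [NormedAddCommGroup G] [InnerProductSpace ℂ G] [FiniteDimensional ℂ G]
    (b : OrthonormalBasis ι ℂ H) (c : OrthonormalBasis κ ℂ H) (T : H →ₗ[ℂ] G) :
    ∑ i, ‖T (b i)‖ ^ 2 = ∑ j, ‖T (c j)‖ ^ 2 := by
  exact_mod_cast (b.sum_sq_norm_map T).trans (c.sum_sq_norm_map T).symm

theorem LinearMap.exists_linearIsometry_of_norm_eq {E : Type*} [AddCommGroup E] [Module ℂ E]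
    (S T : E →ₗ[ℂ] H) (h : ∀ y, ‖S y‖ = ‖T y‖) : ∃ W : H →ₗᵢ[ℂ] H, ∀ y, W (S y) = T y := by
  obtain ⟨g, hg⟩ := S.rangeRestrict.exists_rightInverse_of_surjective S.range_rangeRestrict
  have hSg : ∀ z : S.range, S (g z) = z := fun z =>
    congrArg Subtype.val (LinearMap.congr_fun hg z)
  let L : S.range →ₗᵢ[ℂ] H :=
    { toLinearMap := T ∘ₗ g
      norm_map' := fun z => by
        rw [LinearMap.comp_apply, ← h, hSg]; rfl }
  refine ⟨L.extend, fun y => ?_⟩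
  have h1 : L.extend (S y) = L ⟨S y, y, rfl⟩ := L.extend_apply ⟨S y, y, rfl⟩
  have h2 : T (g ⟨S y, y, rfl⟩ - y) = 0 := by
    rw [← norm_eq_zero, ← h, map_sub, hSg]
    simp
  rw [h1]
  rw [map_sub, sub_eq_zero] at h2
  exact h2

end

theorem Complex.exists_eq_I_mul_of_norm_eq_one {θ : ℂ} (h : ‖θ‖ = 1) :
    ∃ ω : ℝ, -(1 + θ) / (1 - θ) = Complex.I * ω := by
  refine ⟨(-(1 + θ) / (1 - θ)).im, Complex.ext ?_ (by simp)⟩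
  have h2 : Complex.normSq θ = 1 := by rw [Complex.normSq_eq_norm_sq, h]; norm_num
  rw [Complex.normSq_apply] at h2
  rw [Complex.div_re, ← add_div]
  simp only [Complex.neg_re, Complex.add_re, Complex.one_re, Complex.sub_re, Complex.neg_im,
    Complex.add_im, Complex.one_im, Complex.sub_im, Complex.I_mul_re, Complex.ofReal_im, neg_zero]
  rw [div_eq_zero_iff]
  left
  linear_combination h2

section
variable {E F G : Type*} [NormedAddCommGroup E] [InnerProductSpace ℂ E] [FiniteDimensional ℂ E]
  [NormedAddCommGroup F] [InnerProductSpace ℂ F] [NormedAddCommGroup G] [InnerProductSpace ℂ G]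

/-- Every sinusoidal trajectory of `x' = A x + B u`, `y = C x` satisfies `‖y‖ ≤ γ ‖u‖`. -/
def FreqBound (γ : ℝ) (A : E →L[ℂ] E) (B : F →L[ℂ] E) (C : E →L[ℂ] G) : Prop :=
  ∀ (ω : ℝ) (x : E) (u : F), A x + B u = (Complex.I * ω) • x → ‖C x‖ ≤ γ * ‖u‖

/-- The quadratic form of `P` is a storage function for the supply rate `γ² ‖u‖² - ‖C x‖²`. -/
structure IsStorage (γ : ℝ) (A : E →L[ℂ] E) (B : F →L[ℂ] E) (C : E →L[ℂ] G)
    (P : E →L[ℂ] E) : Prop where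
  isSelfAdjoint : IsSelfAdjoint P
  dissipation : ∀ x u, 2 * (⟪P x, A x + B u⟫_ℂ).re + ‖C x‖ ^ 2 ≤ γ ^ 2 * ‖u‖ ^ 2

variable {γ : ℝ} {A : E →L[ℂ] E} {B : F →L[ℂ] E} {C : E →L[ℂ] G}

theorem FreqBound.sum_le [FiniteDimensional ℂ F] [FiniteDimensional ℂ G]
    (hF : FreqBound γ A B C) {r : ℕ} (X : Fin r → E) (U : Fin r → F)
    (h : ∀ P : E →L[ℂ] E, IsSelfAdjoint P → ∑ k, (⟪P (X k), A (X k) + B (U k)⟫_ℂ).re = 0) :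
    ∑ k, ‖C (X k)‖ ^ 2 ≤ γ ^ 2 * ∑ k, ‖U k‖ ^ 2 := by
  let e := EuclideanSpace.basisFun (Fin r) ℂ
  let x : EuclideanSpace ℂ (Fin r) →ₗ[ℂ] E := e.toBasis.constr ℂ X
  let u : EuclideanSpace ℂ (Fin r) →ₗ[ℂ] F := e.toBasis.constr ℂ U
  have hx : ∀ k, x (e k) = X k := fun k => by
    rw [← e.coe_toBasis]; exact e.toBasis.constr_basis ℂ X k
  have hu : ∀ k, u (e k) = U k := fun k => by
    rw [← e.coe_toBasis]; exact e.toBasis.constr_basis ℂ U k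
  let v : EuclideanSpace ℂ (Fin r) →ₗ[ℂ] E := A.toLinearMap ∘ₗ x + B.toLinearMap ∘ₗ u
  have hv : ∀ z, v z = A (x z) + B (u z) := fun z => rfl
  have hadj : ∀ (S : EuclideanSpace ℂ (Fin r) →ₗ[ℂ] E) (y : E),
      ‖S.adjoint y‖ ^ 2 = ∑ k, ‖⟪S (e k), y⟫_ℂ‖ ^ 2 := fun S y => by
    rw [← e.sum_sq_norm_inner_right]
    simp only [LinearMap.adjoint_inner_right]
  have hnorm : ∀ y, ‖(v + x).adjoint y‖ = ‖(v - x).adjoint y‖ := fun y => by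
    rw [← sq_eq_sq₀ (norm_nonneg _) (norm_nonneg _), hadj, hadj, ← sub_eq_zero,
      ← Finset.sum_sub_distrib]
    have h1 := h (InnerProductSpace.rankOne ℂ y y)
      (by
        rw [ContinuousLinearMap.isSelfAdjoint_iff', InnerProductSpace.adjoint_rankOne])
    have h2 : ∀ k, ‖⟪(v + x) (e k), y⟫_ℂ‖ ^ 2 - ‖⟪(v - x) (e k), y⟫_ℂ‖ ^ 2
        = 4 * (⟪InnerProductSpace.rankOne ℂ y y (X k), A (X k) + B (U k)⟫_ℂ).re := fun k => by
      rw [LinearMap.add_apply, LinearMap.sub_apply, hv, hx, hu, inner_add_left, inner_sub_left,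
        InnerProductSpace.rankOne_apply, inner_smul_left, inner_conj_symm,
        ← Complex.normSq_eq_norm_sq, ← Complex.normSq_eq_norm_sq, ← inner_conj_symm y]
      simp only [Complex.normSq_apply, Complex.add_re, Complex.sub_re, Complex.add_im,
        Complex.sub_im, Complex.mul_re, Complex.conj_re, Complex.conj_im]
      ring
    rw [Finset.sum_congr rfl fun k _ => h2 k, ← Finset.mul_sum, h1, mul_zero]
  obtain ⟨W, hW⟩ := LinearMap.exists_linearIsometry_of_norm_eq _ _ hnorm
  obtain ⟨b, hb⟩ := W.exists_orthonormalBasis_eigenvectors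
  have hvx : ∀ z, (v + x) z = (v - x) (W z) := fun z => by
    refine ext_inner_right ℂ fun y => ?_
    rw [← LinearMap.adjoint_inner_right, ← LinearMap.adjoint_inner_right, ← hW, W.inner_map_map]
  have hmode : ∀ i, ‖C (x (b i))‖ ≤ |γ| * ‖u (b i)‖ := fun i => by
    obtain ⟨θ, hθ⟩ := hb i
    have hb0 : b i ≠ 0 := b.orthonormal.ne_zero i
    have hθ1 := W.norm_eq_one_of_eigenvector hb0 hθ
    have h1 := hvx (b i)
    rw [hθ, map_smul, LinearMap.add_apply, LinearMap.sub_apply] at h1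
    by_cases hne : θ = 1
    · have h2 : (2 : ℂ) • x (b i) = 0 := by
        rw [hne] at h1
        linear_combination (norm := module) h1
      rw [(smul_eq_zero.1 h2).resolve_left two_ne_zero, map_zero, norm_zero]
      positivity
    · obtain ⟨ω, hω⟩ := Complex.exists_eq_I_mul_of_norm_eq_one hθ1
      have hne' : 1 - θ ≠ 0 := sub_ne_zero.2 (Ne.symm hne)
      refine (hF ω (x (b i)) (u (b i)) ?_).trans
        (mul_le_mul_of_nonneg_right (le_abs_self γ) (norm_nonneg _))
      rw [← hv, ← hω, div_eq_inv_mul, mul_smul, eq_inv_smul_iff₀ hne']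
      linear_combination (norm := module) h1
  calc ∑ k, ‖C (X k)‖ ^ 2 = ∑ k, ‖(C.toLinearMap ∘ₗ x) (e k)‖ ^ 2 := by simp [hx]
    _ = ∑ i, ‖(C.toLinearMap ∘ₗ x) (b i)‖ ^ 2 := e.sum_sq_norm_map_eq b _
    _ ≤ ∑ i, γ ^ 2 * ‖u (b i)‖ ^ 2 := Finset.sum_le_sum fun i _ => by
        rw [← sq_abs γ, ← mul_pow]
        exact pow_le_pow_left₀ (norm_nonneg _) (hmode i) 2
    _ = γ ^ 2 * ∑ k, ‖u (e k)‖ ^ 2 := by rw [← Finset.mul_sum, e.sum_sq_norm_map_eq b u]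
    _ = γ ^ 2 * ∑ k, ‖U k‖ ^ 2 := by simp [hu]

theorem PointedCone.exists_separating_of_notMem {V : Type*} [NormedAddCommGroup V]
    [NormedSpace ℝ V] [FiniteDimensional ℝ V] (K : PointedCone ℝ V) {v : V} (hv : v ∉ K) :
    ∃ f : V →ₗ[ℝ] ℝ, f ≠ 0 ∧ (∀ a ∈ K, f a ≤ 0) ∧ 0 ≤ f v := by
  have hconv : Convex ℝ (K : Set V) := K.convex
  by_cases hint : (interior (K : Set V)).Nonempty
  · obtain ⟨f, hf0, hf⟩ := geometric_hahn_banach_of_nonempty_interior_point hconv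
      (fun h => hv (interior_subset h)) hint
    refine ⟨f, fun h => hf0 (ContinuousLinearMap.coe_injective h), fun a ha => ?_, ?_⟩
    · by_contra! hpos
      have hpos' : 0 < f a := hpos
      have h0 : 0 ≤ f v := by simpa using hf 0 K.zero_mem
      have h1 := hf (((f v + 1) / f a) • a)
        (K.smul_mem (by positivity : (0 : ℝ) ≤ (f v + 1) / f a) ha)
      rw [map_smul, smul_eq_mul, div_mul_cancel₀ _ hpos'.ne'] at h1
      linarith
    · simpa using hf 0 K.zero_mem
  · rw [hconv.interior_nonempty_iff_affineSpan_eq_top] at hint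
    have hspan : Submodule.span ℝ (K : Set V) < ⊤ := by
      refine lt_top_iff_ne_top.2 fun h => hint ?_
      have h0 : insert 0 (K : Set V) = K := Set.insert_eq_of_mem K.zero_mem
      rw [← AffineSubspace.coe_eq_univ_iff, ← h0, affineSpan_insert_zero, h, Submodule.top_coe]
    obtain ⟨f, hf0, hf⟩ := Submodule.exists_le_ker_of_lt_top _ hspan
    have hfK : ∀ a ∈ K, f a = 0 := fun a ha => hf (Submodule.subset_span ha)
    rcases le_total 0 (f v) with h | h
    · exact ⟨f, hf0, fun a ha => (hfK a ha).le, h⟩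
    · refine ⟨-f, neg_ne_zero.2 hf0, fun a ha => ?_, ?_⟩
      · simp [hfK a ha]
      · simpa using h

theorem FreqBound.exists_isStorage_of_controllable [FiniteDimensional ℂ F] [FiniteDimensional ℂ G]
    (hF : FreqBound γ A B C)
    (hctrl : ∀ (μ : ℂ) (w : E), w ≠ 0 → A.adjoint w = μ • w → B.adjoint w ≠ 0) :
    ∃ P, IsStorage γ A B C P := by
  let Q := selfAdjoint.submodule ℝ (E →L[ℂ] E)
  have hfin : FiniteDimensional ℝ (E →L[ℂ] E) := FiniteDimensional.complexToReal _
  let b := Module.finBasis ℝ Q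
  let g : E × F → (Fin (Module.finrank ℝ Q) → ℝ) × ℝ := fun z =>
    (fun i => (⟪(b i : E →L[ℂ] E) z.1, A z.1 + B z.2⟫_ℂ).re, ‖C z.1‖ ^ 2 - γ ^ 2 * ‖z.2‖ ^ 2)
  have hrepr : ∀ (c : Fin (Module.finrank ℝ Q) → ℝ) (x y : E),
      (⟪((∑ i, c i • b i : Q) : E →L[ℂ] E) x, y⟫_ℂ).re
        = ∑ i, c i * (⟪(b i : E →L[ℂ] E) x, y⟫_ℂ).re := fun c x y => by
    simp only [Submodule.coe_sum, Submodule.coe_smul, _root_.sum_apply,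
      _root_.smul_apply, sum_inner, Complex.re_sum]
    refine Finset.sum_congr rfl fun i _ => ?_
    rw [← Complex.coe_smul, inner_smul_left, Complex.conj_ofReal, Complex.re_ofReal_mul]
  let K : PointedCone ℝ ((Fin (Module.finrank ℝ Q) → ℝ) × ℝ) := Submodule.span _ (Set.range g)
  have hK : ((0, 1) : (Fin (Module.finrank ℝ Q) → ℝ) × ℝ) ∉ K := fun h => by
    obtain ⟨r, t, s, hs⟩ := Submodule.mem_span_set'.1 h
    choose z hz using fun i => (s i).2
    have hsum : ∑ i, (t i : ℝ) • g (z i) = ((0, 1) : (Fin (Module.finrank ℝ Q) → ℝ) × ℝ) := by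
      rw [← hs]
      exact Finset.sum_congr rfl fun i _ => by rw [hz]; rfl
    let X : Fin r → E := fun i => ((√(t i : ℝ) : ℝ) : ℂ) • (z i).1
    let U : Fin r → F := fun i => ((√(t i : ℝ) : ℝ) : ℂ) • (z i).2
    have hsq : ∀ i, √(t i : ℝ) * √(t i : ℝ) = t i := fun i => Real.mul_self_sqrt (t i).2
    have hX : ∀ (P : E →L[ℂ] E) i, (⟪P (X i), A (X i) + B (U i)⟫_ℂ).re
        = t i * (⟪P (z i).1, A (z i).1 + B (z i).2⟫_ℂ).re := fun P i => by
      simp only [X, U, map_smul, ← smul_add, inner_smul_left, inner_smul_right,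
        Complex.conj_ofReal, Complex.re_ofReal_mul]
      rw [← mul_assoc, hsq]
    have h1 : ∀ j, ∑ i, (t i : ℝ) * (⟪(b j : E →L[ℂ] E) (z i).1, A (z i).1 + B (z i).2⟫_ℂ).re
        = 0 := fun j => by
      simpa only [Prod.fst_sum, Prod.smul_fst, Finset.sum_apply, Pi.smul_apply, smul_eq_mul, g,
        Pi.zero_apply] using congrArg (fun p => p.1 j) hsum
    have h2 : ∑ i, (t i : ℝ) * (‖C (z i).1‖ ^ 2 - γ ^ 2 * ‖(z i).2‖ ^ 2) = 1 := by
      simpa only [Prod.snd_sum, Prod.smul_snd, smul_eq_mul, g] using congrArg Prod.snd hsum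
    have h3 := hF.sum_le X U fun P hP => by
      simp only [hX]
      have hPQ : P ∈ Q := hP
      rw [show P = ((∑ i, b.repr ⟨P, hPQ⟩ i • b i : Q) : E →L[ℂ] E) by rw [b.sum_repr]]
      simp only [hrepr, Finset.mul_sum]
      rw [Finset.sum_comm]
      refine Finset.sum_eq_zero fun j _ => ?_
      simp only [mul_left_comm (t _ : ℝ)]
      rw [← Finset.mul_sum, h1, mul_zero]
    have h4 : ∀ i, ‖C (X i)‖ ^ 2 = t i * ‖C (z i).1‖ ^ 2 := fun i => by
      simp only [X, map_smul, norm_smul, mul_pow, Complex.norm_real, Real.norm_eq_abs, sq_abs]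
      rw [sq, hsq]
    have h5 : ∀ i, ‖U i‖ ^ 2 = t i * ‖(z i).2‖ ^ 2 := fun i => by
      simp only [U, norm_smul, mul_pow, Complex.norm_real, Real.norm_eq_abs, sq_abs]
      rw [sq, hsq]
    simp only [h4, h5, Finset.mul_sum] at h3
    rw [← sub_nonpos, ← Finset.sum_sub_distrib] at h3
    have h6 : (1 : ℝ) ≤ 0 := by
      rw [← h2]
      refine le_of_eq_of_le (Finset.sum_congr rfl fun i _ => ?_) h3
      ring
    linarith
  obtain ⟨f, hf0, hfK, hf1⟩ := K.exists_separating_of_notMem hK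
  set c := f (0, 1) with hc
  let a : Fin (Module.finrank ℝ Q) → ℝ := fun i => f (fun j => if i = j then 1 else 0, 0)
  have hf : ∀ p : (Fin (Module.finrank ℝ Q) → ℝ) × ℝ,
      f p = ∑ i, a i * p.1 i + p.2 * c := fun p => by
    have hp : p = LinearMap.inl ℝ _ ℝ p.1
        + p.2 • ((0, 1) : (Fin (Module.finrank ℝ Q) → ℝ) × ℝ) := by ext <;> simp
    conv_lhs => rw [hp, map_add, map_smul, ← LinearMap.comp_apply, LinearMap.pi_apply_eq_sum_univ]
    simp [a, hc, mul_comm]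
  let P : Q := ∑ i, a i • b i
  have hineq : ∀ x u, (⟪(P : E →L[ℂ] E) x, A x + B u⟫_ℂ).re
      + (‖C x‖ ^ 2 - γ ^ 2 * ‖u‖ ^ 2) * c ≤ 0 := fun x u => by
    have := hfK (g (x, u)) (Submodule.subset_span ⟨_, rfl⟩)
    rwa [hf, ← hrepr a x] at this
  rcases hf1.lt_or_eq with hpos | hzero
  · refine ⟨((1 / (2 * c) : ℝ) • P : Q), (((1 / (2 * c) : ℝ) • P : Q)).2, fun x u => ?_⟩
    have h1 := hineq x u
    rw [Submodule.coe_smul, _root_.smul_apply, ← Complex.coe_smul, inner_smul_left,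
      Complex.conj_ofReal, Complex.re_ofReal_mul]
    have h2 : (⟪(P : E →L[ℂ] E) x, A x + B u⟫_ℂ).re
      = c * (2 * (1 / (2 * c) * (⟪(P : E →L[ℂ] E) x, A x + B u⟫_ℂ).re)) := by field_simp
    rw [h2] at h1
    nlinarith
  · exfalso
    have hP : IsSelfAdjoint (P : E →L[ℂ] E) := P.2
    have hsym : ∀ x y, ⟪(P : E →L[ℂ] E) x, y⟫_ℂ = ⟪x, (P : E →L[ℂ] E) y⟫_ℂ := hP.isSymmetric
    have hP0 : (P : E →L[ℂ] E) ≠ 0 := fun h => by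
      have h0 : P = 0 := Subtype.ext h
      have ha := Fintype.linearIndependent_iff.1 b.linearIndependent a h0
      exact hf0 (LinearMap.ext fun p => by simp [hf, ha, ← hzero])
    have hineq' : ∀ x u, (⟪(P : E →L[ℂ] E) x, A x + B u⟫_ℂ).re ≤ 0 := fun x u => by
      simpa [← hzero] using hineq x u
    have hA : ∀ x, (⟪(P : E →L[ℂ] E) x, A x⟫_ℂ).re ≤ 0 := fun x => by simpa using hineq' x 0
    have hB : ∀ x, B.adjoint ((P : E →L[ℂ] E) x) = 0 := fun x => by
      set y := B.adjoint ((P : E →L[ℂ] E) x) with hy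
      have hyy : (⟪(P : E →L[ℂ] E) x, B y⟫_ℂ).re = ‖y‖ ^ 2 := by
        rw [← ContinuousLinearMap.adjoint_inner_left]
        exact inner_self_eq_norm_sq (𝕜 := ℂ) y
      by_contra hy0
      have hpos : 0 < ‖y‖ ^ 2 := by positivity
      set q := (⟪(P : E →L[ℂ] E) x, A x⟫_ℂ).re
      have h1 := hineq' x ((((1 - q) / ‖y‖ ^ 2 : ℝ) : ℂ) • y)
      rw [map_smul, inner_add_right, inner_smul_right, Complex.add_re, Complex.re_ofReal_mul,
        hyy, div_mul_cancel₀ _ hpos.ne'] at h1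
      linarith
    let R := (P : E →L[ℂ] E).range
    have hR : ∀ y, y ∈ Rᗮ → (P : E →L[ℂ] E) y = 0 := fun y hy => ext_inner_right ℂ fun v => by
      rw [hsym, inner_zero_left]
      exact (Submodule.mem_orthogonal' _ _).1 hy _ ⟨v, rfl⟩
    have hinv : ∀ y ∈ R, A.adjoint.toLinearMap y ∈ R := by
      rintro _ ⟨x, rfl⟩
      rw [← R.orthogonal_orthogonal]
      refine (Submodule.mem_orthogonal' _ _).2 fun y hy => ?_
      refine (A.adjoint_inner_left _ _).trans ((hsym _ _).trans ?_)
      rw [map_ker_of_re_inner_nonpos hP hA (hR y hy), inner_zero_right]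
    have hnt : Nontrivial R := Submodule.nontrivial_iff_ne_bot.2 fun h => hP0 (by
      ext x
      have : (P : E →L[ℂ] E) x ∈ R := ⟨x, rfl⟩
      rw [h] at this
      simpa using this)
    obtain ⟨μ, hμ⟩ := Module.End.exists_eigenvalue (A.adjoint.toLinearMap.restrict hinv)
    obtain ⟨⟨w, x, hx⟩, hw⟩ := hμ.exists_hasEigenvector
    have h1 : A.adjoint w = μ • w := congrArg Subtype.val hw.apply_eq_smul
    refine hctrl μ w (fun h => hw.2 (Subtype.ext h)) h1 ?_
    rw [← hx]
    exact hB x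

theorem isStorage_iff [FiniteDimensional ℂ F] (hγ : 0 < γ) {P : E →L[ℂ] E} :
    IsStorage γ A B C P ↔ IsSelfAdjoint P ∧
    ∀ x, 2 * (⟪P x, A x⟫_ℂ).re + (γ ^ 2)⁻¹ * ‖B.adjoint (P x)‖ ^ 2 + ‖C x‖ ^ 2 ≤ 0 := by
  have hexp : ∀ x u, 2 * (⟪P x, A x + B u⟫_ℂ).re + ‖C x‖ ^ 2 - γ ^ 2 * ‖u‖ ^ 2
      = 2 * (⟪P x, A x⟫_ℂ).re + (γ ^ 2)⁻¹ * ‖B.adjoint (P x)‖ ^ 2 + ‖C x‖ ^ 2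
        - γ ^ 2 * ‖u - (((γ ^ 2)⁻¹ : ℝ) : ℂ) • B.adjoint (P x)‖ ^ 2 := fun x u => by
    have h1 : (⟪u, B.adjoint (P x)⟫_ℂ).re = (⟪P x, B u⟫_ℂ).re := by
      rw [← inner_conj_symm, Complex.conj_re, ContinuousLinearMap.adjoint_inner_left]
    rw [norm_sub_sq (𝕜 := ℂ), inner_smul_right, norm_smul, inner_add_right, Complex.add_re,
      RCLike.re_eq_complex_re, Complex.re_ofReal_mul, h1, Complex.norm_real, mul_pow,
      Real.norm_eq_abs, sq_abs]
    field_simp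
    ring
  refine ⟨fun h => ⟨h.1, fun x => ?_⟩, fun h => ⟨h.1, fun x u => ?_⟩⟩
  · have h1 := h.2 x ((((γ ^ 2)⁻¹ : ℝ) : ℂ) • B.adjoint (P x))
    have h2 := hexp x ((((γ ^ 2)⁻¹ : ℝ) : ℂ) • B.adjoint (P x))
    rw [sub_self, norm_zero] at h2
    linarith
  · have h1 := h.2 x
    have h2 := hexp x u
    have h3 : 0 ≤ γ ^ 2 * ‖u - (((γ ^ 2)⁻¹ : ℝ) : ℂ) • B.adjoint (P x)‖ ^ 2 := by positivity
    linarith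

theorem IsStorage.re_inner_nonneg {P : E →L[ℂ] E} (h : IsStorage γ A B C P) (hA : StableOp A)
    (x : E) : 0 ≤ (⟪P x, x⟫_ℂ).re :=
  hA.re_inner_nonneg h.1 (fun x => by
    have := h.2 x 0
    rw [map_zero, add_zero, norm_zero] at this
    nlinarith [sq_nonneg ‖C x‖]) x

theorem isClosed_setOf_isStorage : IsClosed {P | IsStorage γ A B C P} := by
  have : {P | IsStorage γ A B C P} = {P | IsSelfAdjoint P} ∩
      ⋂ x, ⋂ u, {P | 2 * (⟪P x, A x + B u⟫_ℂ).re + ‖C x‖ ^ 2 ≤ γ ^ 2 * ‖u‖ ^ 2} := by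
    ext P
    simp only [Set.mem_ofPred_eq, Set.mem_inter_iff, Set.mem_iInter]
    exact ⟨fun h => ⟨h.1, h.2⟩, fun h => ⟨h.1, h.2⟩⟩
  rw [this]
  refine (isClosed_eq continuous_star continuous_id).inter ?_
  refine isClosed_iInter fun x => isClosed_iInter fun u => isClosed_le ?_ ?_ <;> fun_prop

/-- Moving against an unstable mode of the adjoint closed loop produces another storage function. -/
theorem IsStorage.sub_rankOne [FiniteDimensional ℂ F] (hγ : 0 < γ) {P : E →L[ℂ] E}
    (h : IsStorage γ A B C P) {μ : ℂ} {w : E}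
    (hw : A.adjoint w + (((γ ^ 2)⁻¹ : ℝ) : ℂ) • P (B (B.adjoint w)) = μ • w) {δ : ℝ} (hδ : 0 ≤ δ)
    (hδμ : (γ ^ 2)⁻¹ * δ * ‖B.adjoint w‖ ^ 2 ≤ 2 * μ.re) :
    IsStorage γ A B C (P - (δ : ℂ) • InnerProductSpace.rankOne ℂ w w) := by
  obtain ⟨hP, hR⟩ := (isStorage_iff hγ).1 h
  have hsym : ∀ x y, ⟪P x, y⟫_ℂ = ⟪x, P y⟫_ℂ := hP.isSymmetric
  refine (isStorage_iff hγ).2 ⟨?_, fun x => ?_⟩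
  · refine hP.sub ?_
    rw [ContinuousLinearMap.isSelfAdjoint_iff', map_smulₛₗ, Complex.conj_ofReal,
      InnerProductSpace.adjoint_rankOne]
  · have hx := hR x
    set s := ⟪w, x⟫_ℂ with hs
    set y := B.adjoint (P x) with hy
    set β := B.adjoint w with hβ
    have h1 : ⟪w, A x⟫_ℂ = conj μ * s - (((γ ^ 2)⁻¹ : ℝ) : ℂ) * ⟪β, y⟫_ℂ := by
      rw [← ContinuousLinearMap.adjoint_inner_left, eq_sub_of_add_eq hw, inner_sub_left,
        inner_smul_left, inner_smul_left, Complex.conj_ofReal, hsym, hy,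
        ContinuousLinearMap.adjoint_inner_right]
    have h2 : ⟪β, y⟫_ℂ = conj ⟪y, β⟫_ℂ := (inner_conj_symm _ _).symm
    rw [_root_.sub_apply, _root_.smul_apply, InnerProductSpace.rankOne_apply, ← hs,
      smul_smul, map_sub, map_smul, ← hy, ← hβ, inner_sub_left, inner_smul_left, h1,
      norm_sub_sq (𝕜 := ℂ), norm_smul, inner_smul_right, norm_mul, Complex.norm_real, mul_pow,
      mul_pow, Real.norm_eq_abs, sq_abs,
      map_mul, Complex.conj_ofReal, RCLike.re_eq_complex_re, h2]
    have h3 : ‖s‖ ^ 2 = s.re * s.re + s.im * s.im := by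
      rw [← Complex.normSq_eq_norm_sq, Complex.normSq_apply]
    have h4 : 0 ≤ δ * ‖s‖ ^ 2 * (2 * μ.re - (γ ^ 2)⁻¹ * δ * ‖β‖ ^ 2) :=
      mul_nonneg (by positivity) (sub_nonneg.2 hδμ)
    rw [h3] at h4 ⊢
    simp only [Complex.sub_re, Complex.mul_re, Complex.sub_im, Complex.mul_im, Complex.conj_re,
      Complex.conj_im, Complex.ofReal_re, Complex.ofReal_im]
    generalize (γ ^ 2)⁻¹ = g at *
    linarith

theorem IsStorage.exists_adjoint_re_nonpos [FiniteDimensional ℂ F] (hγ : 0 < γ)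
    (hA : StableOp A) {P₀ : E →L[ℂ] E} (h₀ : IsStorage γ A B C P₀) :
    ∃ P, IsStorage γ A B C P ∧ ∀ (μ : ℂ) (w : E), w ≠ 0 →
      A.adjoint w + (((γ ^ 2)⁻¹ : ℝ) : ℂ) • P (B (B.adjoint w)) = μ • w → μ.re ≤ 0 := by
  let b := stdOrthonormalBasis ℂ E
  let L : (E →L[ℂ] E) →ₗ[ℂ] PiLp 2 fun _ : Fin (Module.finrank ℂ E) => E :=
    { toFun := fun P => WithLp.toLp 2 fun i => P (b i)
      map_add' := fun _ _ => rfl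
      map_smul' := fun _ _ => rfl }
  have hL : Function.Injective L := fun P Q h => by
    have h1 : ∀ i, P (b i) = Q (b i) := fun i => congrFun (congrArg WithLp.ofLp h) i
    exact ContinuousLinearMap.coe_injective (b.toBasis.ext fun i => by simpa using h1 i)
  have hLc : Continuous L := L.continuous_of_finiteDimensional
  have hLe := L.isClosedEmbedding_of_injective (LinearMap.ker_eq_bot.2 hL)
  have hlim : Tendsto (fun P => ‖L P‖) (cocompact _) atTop :=
    (tendsto_norm_cocompact_atTop (E := PiLp 2 fun _ : Fin (Module.finrank ℂ E) => E)).comp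
      hLe.tendsto_cocompact
  obtain ⟨P, hP, hmin⟩ := hLc.norm.continuousOn.exists_isMinOn'
    (isClosed_setOf_isStorage (γ := γ) (A := A) (B := B) (C := C)) h₀
    ((hlim.eventually_ge_atTop ‖L P₀‖).filter_mono inf_le_left)
  refine ⟨P, hP, fun μ w hw0 hw => ?_⟩
  by_contra! hμ
  set δ : ℝ := 2 * μ.re / ((γ ^ 2)⁻¹ * ‖B.adjoint w‖ ^ 2 + 1) with hδ
  have hδ0 : 0 < δ := by positivity
  have hP' : IsStorage γ A B C (P - (δ : ℂ) • InnerProductSpace.rankOne ℂ w w) := by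
    refine hP.sub_rankOne hγ hw hδ0.le ?_
    have : δ * ((γ ^ 2)⁻¹ * ‖B.adjoint w‖ ^ 2 + 1) = 2 * μ.re := by
      rw [hδ]; field_simp
    linarith
  have hsym : ∀ x y, ⟪P x, y⟫_ℂ = ⟪x, P y⟫_ℂ := hP.1.isSymmetric
  have hnn := hP'.re_inner_nonneg hA w
  have hle : ‖L P‖ ≤ ‖L (P - (δ : ℂ) • InnerProductSpace.rankOne ℂ w w)‖ := hmin hP'
  have hinner : ⟪L P, L (InnerProductSpace.rankOne ℂ w w)⟫_ℂ = ⟪w, P w⟫_ℂ := by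
    rw [PiLp.inner_apply, ← b.sum_inner_mul_inner]
    refine Finset.sum_congr rfl fun i _ => ?_
    rw [← hsym]
    exact inner_smul_right _ _ _
  have hnorm : ‖L (InnerProductSpace.rankOne ℂ w w)‖ ^ 2 = ‖w‖ ^ 2 * ‖w‖ ^ 2 := by
    have h1 : ∀ i, ‖L (InnerProductSpace.rankOne ℂ w w) i‖ ^ 2 = ‖⟪w, b i⟫_ℂ‖ ^ 2 * ‖w‖ ^ 2 :=
      fun i => by rw [← mul_pow, ← norm_smul]; rfl
    rw [PiLp.norm_sq_eq_of_L2, Finset.sum_congr rfl fun i _ => h1 i, ← Finset.sum_mul,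
      b.sum_sq_norm_inner_left]
  have hww : ⟪w, w⟫_ℂ = ((‖w‖ ^ 2 : ℝ) : ℂ) := by
    rw [inner_self_eq_norm_sq_to_K, Complex.ofReal_pow]; rfl
  have hsq := pow_le_pow_left₀ (norm_nonneg _) hle 2
  rw [map_sub, map_smul, norm_sub_sq (𝕜 := ℂ), inner_smul_right, hinner, norm_smul, mul_pow, hnorm,
    RCLike.re_eq_complex_re, Complex.re_ofReal_mul, Complex.norm_real, Real.norm_eq_abs,
    sq_abs] at hsq
  rw [_root_.sub_apply, _root_.smul_apply, InnerProductSpace.rankOne_apply, smul_smul,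
    inner_sub_left, inner_smul_left, hsym, Complex.sub_re, map_mul, Complex.conj_ofReal,
    inner_conj_symm, mul_assoc, Complex.re_ofReal_mul, hww, ← Complex.ofReal_mul, Complex.ofReal_re] at hnn
  have hw2 : 0 < ‖w‖ ^ 2 * ‖w‖ ^ 2 := by positivity
  nlinarith [mul_pos hδ0 hw2, mul_pos hδ0 (mul_pos hδ0 hw2)]

/-- Extending a storage function along one uncontrollable stable mode. -/
theorem IsStorage.exists_extension [FiniteDimensional ℂ F] [FiniteDimensional ℂ G] {N : Type*}
    [NormedAddCommGroup N] [InnerProductSpace ℂ N] [FiniteDimensional ℂ N] (hγ : 0 < γ)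
    (J : N →ₗᵢ[ℂ] E) {A' : N →L[ℂ] N} {B' : F →L[ℂ] N}
    {P : N →L[ℂ] N} {w : E} {a l : N} {μ : ℂ} (hw : ‖w‖ = 1) (hwJ : ∀ n, ⟪w, J n⟫_ℂ = 0)
    (hE : ∀ x, ∃ n, x = J n + ⟪w, x⟫_ℂ • w) (hA : ∀ n, A (J n) = J (A' n))
    (hAw : A w = J a + μ • w) (hB : ∀ u, B u = J (B' u)) (hμ : μ.re < 0)
    (hP : IsStorage γ A' B' (C ∘L J.toContinuousLinearMap) P)
    (hl : A'.adjoint l + (((γ ^ 2)⁻¹ : ℝ) : ℂ) • P (B' (B'.adjoint l)) + μ • l + P a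
      + (C ∘L J.toContinuousLinearMap).adjoint (C w) = 0) :
    ∃ P', IsStorage γ A B C P' := by
  obtain ⟨hPs, hR⟩ := (isStorage_iff hγ).1 hP
  have hsym : ∀ x y, ⟪P x, y⟫_ℂ = ⟪x, P y⟫_ℂ := hPs.isSymmetric
  have hww : ⟪w, w⟫_ℂ = 1 := by rw [inner_self_eq_norm_sq_to_K, hw]; simp
  have hJw : ∀ n, ⟪J n, w⟫_ℂ = 0 := fun n => by rw [← inner_conj_symm, hwJ, map_zero]
  let k : ℝ := (2 * (⟪l, a⟫_ℂ).re + ‖C w‖ ^ 2 + (γ ^ 2)⁻¹ * ‖B'.adjoint l‖ ^ 2) / (-(2 * μ.re))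
  have hk : k * (-(2 * μ.re))
      = 2 * (⟪l, a⟫_ℂ).re + ‖C w‖ ^ 2 + (γ ^ 2)⁻¹ * ‖B'.adjoint l‖ ^ 2 :=
    div_mul_cancel₀ _ (by linarith)
  let j := J.toContinuousLinearMap
  have hj : ∀ n β, j.adjoint (J n + β • w) = n := fun n β => ext_inner_right ℂ fun v => by
    rw [ContinuousLinearMap.adjoint_inner_left, inner_add_left, inner_smul_left]
    change ⟪J n, J v⟫_ℂ + _ * ⟪w, J v⟫_ℂ = _
    rw [hwJ, mul_zero, add_zero, J.inner_map_map]
  have hBj : ∀ n β, B.adjoint (J n + β • w) = B'.adjoint n := fun n β =>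
    ext_inner_right ℂ fun v => by
      rw [ContinuousLinearMap.adjoint_inner_left, ContinuousLinearMap.adjoint_inner_left, hB,
        inner_add_left, inner_smul_left, hwJ, mul_zero, add_zero, J.inner_map_map]
  let P' : E →L[ℂ] E := j ∘L P ∘L j.adjoint + (InnerProductSpace.rankOne ℂ w (J l)
    + InnerProductSpace.rankOne ℂ (J l) w) + (k : ℂ) • InnerProductSpace.rankOne ℂ w w
  have hP' : ∀ n α, P' (J n + α • w) = J (P n + α • l) + (⟪l, n⟫_ℂ + k * α) • w := fun n α => by
    have h1 : P' (J n + α • w) = J (P (j.adjoint (J n + α • w)))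
        + (⟪J l, J n + α • w⟫_ℂ • w + ⟪w, J n + α • w⟫_ℂ • J l)
        + (k : ℂ) • ⟪w, J n + α • w⟫_ℂ • w := rfl
    rw [h1, hj, inner_add_right, inner_add_right, J.inner_map_map, inner_smul_right,
      inner_smul_right, hJw, hwJ, hww, map_add, map_smul]
    module
  refine ⟨P', (isStorage_iff hγ).2 ⟨?_, fun x => ?_⟩⟩
  · refine IsSelfAdjoint.add (IsSelfAdjoint.add ?_ ?_) ?_
    · exact hPs.conj_adjoint j
    · rw [ContinuousLinearMap.isSelfAdjoint_iff', map_add, InnerProductSpace.adjoint_rankOne,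
        InnerProductSpace.adjoint_rankOne, add_comm]
    · rw [ContinuousLinearMap.isSelfAdjoint_iff', map_smulₛₗ, Complex.conj_ofReal,
        InnerProductSpace.adjoint_rankOne]
  · obtain ⟨n, hn⟩ := hE x
    generalize ⟪w, x⟫_ℂ = α at hn
    have hx := hR n
    have hAx : A x = J (A' n + α • a) + (α * μ) • w := by
      rw [hn, map_add, map_smul, hA, hAw, map_add, map_smul]
      module
    have hinn : ⟪P' x, A x⟫_ℂ = ⟪P n + α • l, A' n + α • a⟫_ℂ
        + conj (⟪l, n⟫_ℂ + k * α) * (α * μ) := by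
      rw [hn, hP', ← hn, hAx, inner_add_left, inner_add_right, inner_add_right, J.inner_map_map,
        inner_smul_left, inner_smul_left, inner_smul_right, inner_smul_right, hJw, hwJ, hww]
      ring
    have hCx : C x = C (J n) + α • C w := by rw [hn, map_add, map_smul]
    have hBx : B.adjoint (P' x) = B'.adjoint (P n) + α • B'.adjoint l := by
      rw [hn, hP', hBj, map_add, map_smul]
    have heq := congrArg (fun z => ⟪n, z⟫_ℂ) hl
    simp only [inner_add_right, inner_smul_right, inner_zero_right,
      ContinuousLinearMap.adjoint_inner_right] at heq
    rw [← hsym, ← hsym, ← ContinuousLinearMap.adjoint_inner_left B'] at heq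
    change _ + _ + _ + _ + ⟪C (J n), C w⟫_ℂ = 0 at heq
    change 2 * _ + _ + ‖C (J n)‖ ^ 2 ≤ 0 at hx
    have h3 : ‖α‖ ^ 2 = α.re * α.re + α.im * α.im := by
      rw [← Complex.normSq_eq_norm_sq, Complex.normSq_apply]
    rw [hinn, hCx, hBx, norm_add_sq (𝕜 := ℂ), norm_add_sq (𝕜 := ℂ), norm_smul, norm_smul, mul_pow,
      mul_pow, h3, inner_smul_right, inner_smul_right, inner_add_left, inner_add_right,
      inner_add_right, inner_smul_left, inner_smul_left, inner_smul_right, inner_smul_right,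
      ← inner_conj_symm l n, ← inner_conj_symm l (A' n), RCLike.re_eq_complex_re]
    have hre := congrArg Complex.re heq
    have him := congrArg Complex.im heq
    simp only [Complex.add_re, Complex.mul_re, Complex.add_im, Complex.mul_im, Complex.conj_re,
      Complex.conj_im, Complex.ofReal_re, Complex.ofReal_im, map_add, map_mul, Complex.conj_conj,
      Complex.conj_ofReal, Complex.zero_re, Complex.zero_im] at hre him ⊢
    clear_value k
    generalize (γ ^ 2)⁻¹ = g at *
    linear_combination hx + 2 * α.re * hre - 2 * α.im * him
      - (α.re * α.re + α.im * α.im) * hk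

theorem StableOp.adjoint_eigenvalue {A : E →L[ℂ] E} (hA : StableOp A) {ν : ℂ} {w : E} (hw0 : w ≠ 0)
    (hw : A.adjoint w = ν • w) : ν.re < 0 := by
  by_contra! hν
  have hu : IsUnit (A - conj ν • (1 : E →L[ℂ] E)) := by
    refine ContinuousLinearMap.isUnit_of_forall_eq_zero _ fun x hx => ?_
    by_contra hx0
    have := hA (conj ν) x hx0 (sub_eq_zero.1 hx)
    rw [Complex.conj_re] at this
    linarith
  obtain ⟨z, hz⟩ := (ContinuousLinearMap.isUnit_iff_bijective.1 hu).2 w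
  have hz' : A z - conj ν • z = w := hz
  refine hw0 ((inner_self_eq_zero (𝕜 := ℂ)).1 ?_)
  nth_rewrite 2 [← hz']
  rw [inner_sub_right, ← ContinuousLinearMap.adjoint_inner_left, hw, inner_smul_left,
    inner_smul_right, sub_self]

theorem FreqBound.exists_isStorage {E F G : Type*}
    [NormedAddCommGroup E] [InnerProductSpace ℂ E] [FiniteDimensional ℂ E]
    [NormedAddCommGroup F] [InnerProductSpace ℂ F] [FiniteDimensional ℂ F]
    [NormedAddCommGroup G] [InnerProductSpace ℂ G] [FiniteDimensional ℂ G]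
    {γ : ℝ} {A : E →L[ℂ] E} {B : F →L[ℂ] E} {C : E →L[ℂ] G} (hγ : 0 < γ) (hA : StableOp A)
    (hF : FreqBound γ A B C) : ∃ P, IsStorage γ A B C P := by
  induction hd : Module.finrank ℂ E using Nat.strong_induction_on generalizing E with
  | _ d ih =>
  by_cases hctrl : ∀ (μ : ℂ) (w : E), w ≠ 0 → A.adjoint w = μ • w → B.adjoint w ≠ 0
  · exact hF.exists_isStorage_of_controllable hctrl
  push Not at hctrl
  obtain ⟨ν, w₀, hw₀, hAw₀, hBw₀⟩ := hctrl
  have hν := hA.adjoint_eigenvalue hw₀ hAw₀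
  obtain ⟨w, hw, hAw, hBw⟩ : ∃ w : E, ‖w‖ = 1 ∧ A.adjoint w = ν • w ∧ B.adjoint w = 0 := by
    refine ⟨((‖w₀‖⁻¹ : ℝ) : ℂ) • w₀, ?_, ?_, ?_⟩
    · rw [norm_smul, Complex.norm_real, norm_inv, norm_norm,
        inv_mul_cancel₀ (norm_ne_zero_iff.2 hw₀)]
    · rw [map_smul, hAw₀, smul_comm]
    · rw [map_smul, hBw₀, smul_zero]
  have hww : ⟪w, w⟫_ℂ = 1 := by rw [inner_self_eq_norm_sq_to_K, hw]; simp
  have hw0 : w ≠ 0 := by rintro rfl; simp at hw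
  let N := (ℂ ∙ w)ᗮ
  have hN : ∀ x, x ∈ N ↔ ⟪w, x⟫_ℂ = 0 := fun x =>
    Submodule.mem_orthogonal_singleton_iff_inner_right
  have hwA : ∀ x, ⟪w, A x⟫_ℂ = conj ν * ⟪w, x⟫_ℂ := fun x => by
    rw [← ContinuousLinearMap.adjoint_inner_left, hAw, inner_smul_left]
  have hwB : ∀ u, ⟪w, B u⟫_ℂ = 0 := fun u => by
    rw [← ContinuousLinearMap.adjoint_inner_left, hBw, inner_zero_left]
  let J : N →ₗᵢ[ℂ] E := N.subtypeₗᵢ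
  let A' : N →L[ℂ] N := (A ∘L N.subtypeL).codRestrict N fun n => (hN _).2 (by
    rw [ContinuousLinearMap.comp_apply, hwA, N.subtypeL_apply, (hN _).1 n.2, mul_zero])
  let B' : F →L[ℂ] N := B.codRestrict N fun u => (hN _).2 (hwB u)
  let C' : N →L[ℂ] G := C ∘L J.toContinuousLinearMap
  have hdim : Module.finrank ℂ N < d := hd ▸ Submodule.finrank_lt fun h => hw0 (by
    have : w ∈ N := h ▸ Submodule.mem_top
    exact (inner_self_eq_zero (𝕜 := ℂ)).1 ((hN w).1 this))
  have hA' : StableOp A' := fun μ x hx h =>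
    hA μ x (fun h0 => hx (Subtype.ext h0)) (congrArg Subtype.val h)
  obtain ⟨P₀, hP₀⟩ := ih _ hdim (A := A') (B := B') (C := C') hA'
    (fun ω x u h => hF ω x u (congrArg Subtype.val h)) rfl
  obtain ⟨P, hP, hPμ⟩ := hP₀.exists_adjoint_re_nonpos hγ hA'
  let a : N := ⟨A w - conj ν • w, (hN _).2 (by
    rw [inner_sub_right, inner_smul_right, hwA, sub_self])⟩
  have hμ : (conj ν).re < 0 := by rwa [Complex.conj_re]
  let T : N →L[ℂ] N := A'.adjoint + (((γ ^ 2)⁻¹ : ℝ) : ℂ) • (P ∘L B' ∘L B'.adjoint)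
    + conj ν • (1 : N →L[ℂ] N)
  have hT : ∀ l, T l = A'.adjoint l + (((γ ^ 2)⁻¹ : ℝ) : ℂ) • P (B' (B'.adjoint l)) + conj ν • l :=
    fun l => rfl
  have hTu : IsUnit T := T.isUnit_of_forall_eq_zero fun l hl => by
    by_contra hl0
    have := hPμ (-conj ν) l hl0 (by
      rw [neg_smul]
      exact eq_neg_of_add_eq_zero_left hl)
    rw [Complex.neg_re] at this
    linarith
  obtain ⟨l, hl⟩ := (ContinuousLinearMap.isUnit_iff_bijective.1 hTu).2
    (-(P a + C'.adjoint (C w)))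
  refine hP.exists_extension hγ J (A' := A') (B' := B') (w := w) (a := a) (l := l) (μ := conj ν) hw
    (fun n => (hN _).1 n.2)
    (fun x => ⟨⟨x - ⟪w, x⟫_ℂ • w, (hN _).2 ?_⟩, ?_⟩) (fun n => rfl) ?_ (fun u => rfl) hμ ?_
  · rw [inner_sub_right, inner_smul_right, hww, mul_one, sub_self]
  · exact (sub_add_cancel _ _).symm
  · exact (sub_add_cancel _ _).symm
  · rw [← hT, hl, add_assoc]
    exact neg_add_cancel _

theorem IsSelfAdjoint.apply_eq_zero_of_re_inner_eq_zero {P : E →L[ℂ] E} (hP : IsSelfAdjoint P)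
    (h : ∀ x, 0 ≤ (⟪P x, x⟫_ℂ).re) {x : E} (hx : (⟪P x, x⟫_ℂ).re = 0) : P x = 0 := by
  set y := P x with hy
  have hyy : (⟪y, y⟫_ℂ).re = ‖y‖ ^ 2 := inner_self_eq_norm_sq (𝕜 := ℂ) y
  have hyx : (⟪P y, x⟫_ℂ).re = ‖y‖ ^ 2 := by
    rw [show ⟪P y, x⟫_ℂ = ⟪y, P x⟫_ℂ from hP.isSymmetric y x, ← hy, hyy]
  have hc := h y
  set c := (⟪P y, y⟫_ℂ).re
  set s := ‖y‖ ^ 2 / (1 + c) with hs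
  have hys : ‖y‖ ^ 2 = s * (1 + c) := by rw [hs]; field_simp
  have key := h (x + ((-s : ℝ) : ℂ) • y)
  simp only [map_add, map_smul, ← hy, inner_add_left, inner_add_right, inner_smul_left,
    inner_smul_right, Complex.add_re, Complex.conj_ofReal, Complex.re_ofReal_mul, hx, hyy,
    hyx] at key
  rw [hys] at key
  have hs0 : s = 0 := by
    have : s ^ 2 ≤ 0 := by nlinarith [mul_nonneg (sq_nonneg s) hc]
    exact pow_eq_zero_iff two_ne_zero |>.1 (le_antisymm this (sq_nonneg s))
  rw [hs0, zero_mul] at hys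
  simpa using hys

theorem IsStorage.eq_zero_of_apply_eq_zero {P : E →L[ℂ] E} (h : IsStorage γ A B C P)
    (hobs : ∀ (μ : ℂ) (v : E), v ≠ 0 → A v = μ • v → C v ≠ 0) {x : E} (hx : P x = 0) : x = 0 := by
  have hinv : ∀ y ∈ P.ker, A.toLinearMap y ∈ P.ker := fun y hy =>
    map_ker_of_re_inner_nonpos h.1 (fun z => by
      have := h.2 z 0
      rw [map_zero, add_zero, norm_zero] at this
      nlinarith [sq_nonneg ‖C z‖]) hy
  by_contra hx0
  have hnt : Nontrivial P.ker := ⟨⟨x, hx⟩, 0, fun h0 => hx0 (congrArg Subtype.val h0)⟩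
  obtain ⟨μ, hμ⟩ := Module.End.exists_eigenvalue (A.toLinearMap.restrict hinv)
  obtain ⟨⟨v, hv⟩, hvμ⟩ := hμ.exists_hasEigenvector
  refine hobs μ v (fun h0 => hvμ.2 (Subtype.ext h0)) (congrArg Subtype.val hvμ.apply_eq_smul) ?_
  have h1 := h.2 v 0
  rw [show P v = 0 from hv, inner_zero_left, norm_zero] at h1
  have h2 : ‖C v‖ ^ 2 ≤ 0 := by simpa using h1
  simpa using h2

theorem IsStorage.re_inner_pos {P : E →L[ℂ] E} (h : IsStorage γ A B C P) (hA : StableOp A)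
    (hobs : ∀ (μ : ℂ) (v : E), v ≠ 0 → A v = μ • v → C v ≠ 0) {x : E} (hx : x ≠ 0) :
    0 < (⟪P x, x⟫_ℂ).re :=
  (h.re_inner_nonneg hA x).lt_of_ne fun h0 => hx <| h.eq_zero_of_apply_eq_zero hobs <|
    h.1.apply_eq_zero_of_re_inner_eq_zero (h.re_inner_nonneg hA) h0.symm

theorem IsStorage.re_inner_smul {P : E →L[ℂ] E} (h : IsStorage γ A B C P) (μ : ℂ) (x : E) :
    (⟪P x, μ • x⟫_ℂ).re = μ.re * (⟪P x, x⟫_ℂ).re := by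
  have him : (⟪P x, x⟫_ℂ).im = 0 := by
    rw [← Complex.conj_eq_iff_im, inner_conj_symm]
    exact (h.1.isSymmetric x x).symm
  rw [inner_smul_right, Complex.mul_re, him, mul_zero, sub_zero]

theorem IsStorage.stableOp {P : E →L[ℂ] E} (h : IsStorage γ A B C P)
    (hP : ∀ x, x ≠ 0 → 0 < (⟪P x, x⟫_ℂ).re)
    (hobs : ∀ (μ : ℂ) (v : E), v ≠ 0 → A v = μ • v → C v ≠ 0) : StableOp A := fun μ v hv hμ => by
  have h1 := h.2 v 0
  rw [map_zero, add_zero, norm_zero, hμ, h.re_inner_smul] at h1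
  have h2 : 0 < ‖C v‖ ^ 2 := by
    have := norm_pos_iff.2 (hobs μ v hv hμ)
    positivity
  by_contra! h3
  have := mul_nonneg h3 (hP v hv).le
  linarith

theorem IsStorage.freqBound {P : E →L[ℂ] E} (h : IsStorage γ A B C P) (hγ : 0 < γ) :
    FreqBound γ A B C := fun ω x u hx => by
  have h1 := h.2 x u
  rw [hx, h.re_inner_smul] at h1
  refine (sq_le_sq₀ (norm_nonneg _) (by positivity)).1 ?_
  rw [mul_pow]
  simpa using h1

end

section
variable {ι κ τ : Type*} [Fintype ι] [Fintype κ] [Fintype τ]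

theorem Matrix.riccati_quadForm {γ : ℝ} (A P : Matrix ι ι ℝ) (B : Matrix ι κ ℝ) (C : Matrix τ ι ℝ)
    (hP : P.IsSymm) (x : ι → ℝ) :
    x ⬝ᵥ ((Aᵀ * P + P * A + (γ ^ 2)⁻¹ • (P * B * Bᵀ * P) + Cᵀ * C) *ᵥ x)
      = 2 * ((P *ᵥ x) ⬝ᵥ (A *ᵥ x)) + (γ ^ 2)⁻¹ * ((Bᵀ *ᵥ P *ᵥ x) ⬝ᵥ (Bᵀ *ᵥ P *ᵥ x))
        + (C *ᵥ x) ⬝ᵥ (C *ᵥ x) := by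
  have hP' : ∀ y, x ⬝ᵥ (P *ᵥ y) = (P *ᵥ x) ⬝ᵥ y := fun y => by
    rw [dotProduct_mulVec, ← mulVec_transpose, hP.eq]
  have hA : ∀ y, x ⬝ᵥ (Aᵀ *ᵥ y) = (A *ᵥ x) ⬝ᵥ y := fun y => by
    rw [dotProduct_mulVec, vecMul_transpose]
  have hC : ∀ y, x ⬝ᵥ (Cᵀ *ᵥ y) = (C *ᵥ x) ⬝ᵥ y := fun y => by
    rw [dotProduct_mulVec, vecMul_transpose]
  have hB : ∀ y z, z ⬝ᵥ (B *ᵥ y) = (Bᵀ *ᵥ z) ⬝ᵥ y := fun y z => by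
    rw [dotProduct_mulVec, mulVec_transpose]
  simp only [add_mulVec, smul_mulVec, ← mulVec_mulVec, dotProduct_add, dotProduct_smul, hP', hA, hC,
    hB, smul_eq_mul]
  rw [dotProduct_comm (A *ᵥ x)]
  ring

theorem Matrix.posSemidef_neg_riccati_iff {γ : ℝ} (hγ : 0 < γ) (A P : Matrix ι ι ℝ)
    (B : Matrix ι κ ℝ) (C : Matrix τ ι ℝ) (hP : P.IsSymm) :
    (-(Aᵀ * P + P * A + (γ ^ 2)⁻¹ • (P * B * Bᵀ * P) + Cᵀ * C)).PosSemidef ↔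
      ∀ x u, 2 * ((P *ᵥ x) ⬝ᵥ (A *ᵥ x + B *ᵥ u)) + (C *ᵥ x) ⬝ᵥ (C *ᵥ x) ≤ γ ^ 2 * (u ⬝ᵥ u) := by
  have hsymm : (-(Aᵀ * P + P * A + (γ ^ 2)⁻¹ • (P * B * Bᵀ * P) + Cᵀ * C)).IsHermitian := by
    rw [IsHermitian, conjTranspose_eq_transpose_of_trivial]
    simp only [transpose_neg, transpose_add, transpose_smul, transpose_mul, transpose_transpose,
      hP.eq, Matrix.mul_assoc]
    rw [add_comm (P * A)]
  have hB : ∀ y z, z ⬝ᵥ (B *ᵥ y) = (Bᵀ *ᵥ z) ⬝ᵥ y := fun y z => by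
    rw [dotProduct_mulVec, mulVec_transpose]
  rw [posSemidef_iff_dotProduct_mulVec, and_iff_right hsymm]
  simp only [neg_mulVec, dotProduct_neg, star_trivial, riccati_quadForm A P B C hP, neg_nonneg]
  refine ⟨fun h x u => ?_, fun h x => ?_⟩
  · have h1 := h x
    set y := Bᵀ *ᵥ P *ᵥ x
    have h2 : 0 ≤ γ ^ 2 * ((u - (γ ^ 2)⁻¹ • y) ⬝ᵥ (u - (γ ^ 2)⁻¹ • y)) :=
      mul_nonneg (by positivity) (by simpa using dotProduct_star_self_nonneg (u - (γ ^ 2)⁻¹ • y))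
    have h3 : γ ^ 2 * ((u - (γ ^ 2)⁻¹ • y) ⬝ᵥ (u - (γ ^ 2)⁻¹ • y))
        = γ ^ 2 * (u ⬝ᵥ u) - 2 * (y ⬝ᵥ u) + (γ ^ 2)⁻¹ * (y ⬝ᵥ y) := by
      simp only [sub_dotProduct, dotProduct_sub, smul_dotProduct, dotProduct_smul, smul_eq_mul]
      rw [dotProduct_comm u y]
      field_simp
      ring
    rw [dotProduct_add, hB]
    linarith
  · have h1 := h x ((γ ^ 2)⁻¹ • (Bᵀ *ᵥ P *ᵥ x))
    rw [dotProduct_add, hB, dotProduct_smul, smul_dotProduct, dotProduct_smul, smul_eq_mul,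
      smul_eq_mul, mul_inv_cancel_left₀ (by positivity)] at h1
    linarith

/-- A real matrix acting on complex Euclidean space. -/
noncomputable def Matrix.complexMap [DecidableEq ι] (M : Matrix κ ι ℝ) :
    EuclideanSpace ℂ ι →L[ℂ] EuclideanSpace ℂ κ :=
  LinearMap.toContinuousLinearMap (M.map (algebraMap ℝ ℂ)).toEuclideanLin

theorem Matrix.complexMap_apply [DecidableEq ι] (M : Matrix κ ι ℝ) (x : EuclideanSpace ℂ ι) :
    M.complexMap x = WithLp.toLp 2 (M.map (algebraMap ℝ ℂ) *ᵥ x.ofLp) := rfl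

theorem Matrix.re_complexMap [DecidableEq ι] (M : Matrix κ ι ℝ) (x : EuclideanSpace ℂ ι) :
    (fun i => (M.complexMap x i).re) = M *ᵥ fun i => (x i).re := by
  ext i
  simp [complexMap_apply, mulVec, dotProduct]

theorem Matrix.im_complexMap [DecidableEq ι] (M : Matrix κ ι ℝ) (x : EuclideanSpace ℂ ι) :
    (fun i => (M.complexMap x i).im) = M *ᵥ fun i => (x i).im := by
  ext i
  simp [complexMap_apply, mulVec, dotProduct]

theorem EuclideanSpace.re_inner_eq (x y : EuclideanSpace ℂ ι) : (⟪x, y⟫_ℂ).re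
    = (fun i => (x i).re) ⬝ᵥ (fun i => (y i).re) + (fun i => (x i).im) ⬝ᵥ fun i => (y i).im := by
  rw [PiLp.inner_apply, Complex.re_sum, dotProduct, dotProduct, ← Finset.sum_add_distrib]
  refine Finset.sum_congr rfl fun i _ => ?_
  simp
  ring

theorem EuclideanSpace.norm_sq_eq_dotProduct (x : EuclideanSpace ℂ ι) : ‖x‖ ^ 2
    = (fun i => (x i).re) ⬝ᵥ (fun i => (x i).re) + (fun i => (x i).im) ⬝ᵥ fun i => (x i).im := by
  rw [← re_inner_eq]
  exact (inner_self_eq_norm_sq (𝕜 := ℂ) x).symm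

theorem Matrix.mem_spectrum_iff_exists_mulVec [DecidableEq ι] (M : Matrix ι ι ℂ) (μ : ℂ) :
    μ ∈ spectrum ℂ M ↔ ∃ v, v ≠ 0 ∧ M *ᵥ v = μ • v := by
  rw [spectrum.mem_iff, isUnit_iff_isUnit_det, isUnit_iff_ne_zero, not_not,
    ← exists_mulVec_eq_zero_iff]
  refine exists_congr fun v => and_congr_right fun _ => ?_
  rw [sub_mulVec, sub_eq_zero, Algebra.algebraMap_eq_smul_one, smul_mulVec, one_mulVec, eq_comm]

theorem isHurwitz_iff_stableOp [DecidableEq ι] (M : Matrix ι ι ℝ) :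
    IsHurwitz M ↔ StableOp M.complexMap := by
  simp only [IsHurwitz, StableOp, mem_spectrum_iff_exists_mulVec]
  refine ⟨fun h μ x hx hμ => h μ ⟨x.ofLp, ?_, congrArg WithLp.ofLp hμ⟩,
    fun h μ ⟨v, hv, hμ⟩ => h μ (WithLp.toLp 2 v) ?_ (congrArg (WithLp.toLp 2) hμ)⟩
  · exact fun h0 => hx (WithLp.ofLp_injective 2 h0)
  · exact fun h0 => hv (WithLp.toLp_injective 2 h0)

theorem PBHObservable.complexMap_ne_zero [DecidableEq ι] {C : Matrix τ ι ℝ} {A : Matrix ι ι ℝ}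
    (h : PBHObservable C A) (μ : ℂ) (v : EuclideanSpace ℂ ι) (hv : v ≠ 0)
    (hμ : A.complexMap v = μ • v) : C.complexMap v ≠ 0 := fun h0 =>
  h μ v.ofLp (fun h0 => hv (WithLp.ofLp_injective 2 h0)) (congrArg WithLp.ofLp hμ)
    (congrArg WithLp.ofLp h0)

theorem freqBound_iff [DecidableEq ι] [DecidableEq κ] {γ : ℝ} {A : Matrix ι ι ℝ}
    {B : Matrix ι κ ℝ} {C : Matrix τ ι ℝ} (hA : ∀ ω : ℝ,
      IsUnit ((Complex.I * (ω : ℂ)) • (1 : Matrix ι ι ℂ) - A.map (algebraMap ℝ ℂ))) :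
    FreqBound γ A.complexMap B.complexMap C.complexMap ↔ ∀ (ω : ℝ) (v : κ → ℂ),
      euclNorm ((C.map (algebraMap ℝ ℂ)
          * ((Complex.I * (ω : ℂ)) • (1 : Matrix ι ι ℂ) - A.map (algebraMap ℝ ℂ))⁻¹
          * B.map (algebraMap ℝ ℂ)) *ᵥ v) ≤ γ * euclNorm v := by
  refine forall_congr' fun ω => ?_
  have hdet := (isUnit_iff_isUnit_det _).1 (hA ω)
  set M := (Complex.I * (ω : ℂ)) • (1 : Matrix ι ι ℂ) - A.map (algebraMap ℝ ℂ) with hM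
  have hMx : ∀ x : ι → ℂ, M *ᵥ x = (Complex.I * ω) • x - A.map (algebraMap ℝ ℂ) *ᵥ x := fun x => by
    rw [hM, sub_mulVec, smul_mulVec, one_mulVec]
  refine ⟨fun h v => ?_, fun h x u hx => ?_⟩
  · rw [← mulVec_mulVec, ← mulVec_mulVec]
    refine h (WithLp.toLp 2 (M⁻¹ *ᵥ B.map (algebraMap ℝ ℂ) *ᵥ v)) (WithLp.toLp 2 v) ?_
    have h1 := hMx (M⁻¹ *ᵥ B.map (algebraMap ℝ ℂ) *ᵥ v)
    rw [mulVec_mulVec, mul_nonsing_inv _ hdet, one_mulVec] at h1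
    refine WithLp.ofLp_injective 2 ?_
    change A.map (algebraMap ℝ ℂ) *ᵥ M⁻¹ *ᵥ B.map (algebraMap ℝ ℂ) *ᵥ v
        + B.map (algebraMap ℝ ℂ) *ᵥ v
      = (Complex.I * ω) • M⁻¹ *ᵥ B.map (algebraMap ℝ ℂ) *ᵥ v
    nth_rewrite 2 [h1]
    abel
  · have h1 := h u.ofLp
    have h2 : A.map (algebraMap ℝ ℂ) *ᵥ x.ofLp + B.map (algebraMap ℝ ℂ) *ᵥ u.ofLp
        = (Complex.I * ω) • x.ofLp := congrArg WithLp.ofLp hx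
    have h3 : B.map (algebraMap ℝ ℂ) *ᵥ u.ofLp = M *ᵥ x.ofLp := by
      rw [hMx, ← h2, add_sub_cancel_left]
    rw [← mulVec_mulVec, ← mulVec_mulVec, h3, mulVec_mulVec _ M⁻¹, nonsing_inv_mul _ hdet,
      one_mulVec] at h1
    exact h1

theorem IsHurwitz.isUnit [DecidableEq ι] {A : Matrix ι ι ℝ} (hA : IsHurwitz A) (ω : ℝ) :
    IsUnit ((Complex.I * (ω : ℂ)) • (1 : Matrix ι ι ℂ) - A.map (algebraMap ℝ ℂ)) := by
  have h : Complex.I * (ω : ℂ) ∉ spectrum ℂ (A.map (algebraMap ℝ ℂ)) := fun h => by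
    simpa using hA _ h
  rwa [spectrum.notMem_iff, Algebra.algebraMap_eq_smul_one] at h

theorem isStorage_complexMap [DecidableEq ι] [DecidableEq κ] {γ : ℝ} {A P : Matrix ι ι ℝ}
    {B : Matrix ι κ ℝ} {C : Matrix τ ι ℝ} (hP : P.IsSymm)
    (h : ∀ x u, 2 * ((P *ᵥ x) ⬝ᵥ (A *ᵥ x + B *ᵥ u)) + (C *ᵥ x) ⬝ᵥ (C *ᵥ x) ≤ γ ^ 2 * (u ⬝ᵥ u)) :
    IsStorage γ A.complexMap B.complexMap C.complexMap P.complexMap := by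
  refine ⟨?_, fun x u => ?_⟩
  · rw [ContinuousLinearMap.isSelfAdjoint_iff_isSymmetric]
    refine isSymmetric_toEuclideanLin_iff.2 ?_
    ext i j
    simp [hP.apply i j]
  · have h1 := h (fun i => (x i).re) fun i => (u i).re
    have h2 := h (fun i => (x i).im) fun i => (u i).im
    rw [inner_add_right, Complex.add_re, EuclideanSpace.re_inner_eq, EuclideanSpace.re_inner_eq,
      EuclideanSpace.norm_sq_eq_dotProduct, EuclideanSpace.norm_sq_eq_dotProduct]
    simp only [re_complexMap, im_complexMap]
    rw [dotProduct_add] at h1 h2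
    linarith

/-- The real part of the matrix of an operator on complex Euclidean space. -/
noncomputable def ContinuousLinearMap.reMatrix [DecidableEq ι]
    (P : EuclideanSpace ℂ ι →L[ℂ] EuclideanSpace ℂ ι) : Matrix ι ι ℝ :=
  Matrix.of fun i j => (P (EuclideanSpace.single j 1) i).re

/-- The complexification of a real vector. -/
noncomputable def EuclideanSpace.ofReal (x : ι → ℝ) : EuclideanSpace ℂ ι :=
  WithLp.toLp 2 fun i => (x i : ℂ)

theorem Matrix.complexMap_ofReal [DecidableEq ι] (M : Matrix κ ι ℝ) (x : ι → ℝ) :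
    M.complexMap (EuclideanSpace.ofReal x) = EuclideanSpace.ofReal (M *ᵥ x) := by
  ext i
  simp [complexMap_apply, mulVec, dotProduct, EuclideanSpace.ofReal]

theorem EuclideanSpace.norm_sq_ofReal (x : ι → ℝ) : ‖ofReal x‖ ^ 2 = x ⬝ᵥ x := by
  simp [norm_sq_eq_dotProduct, ofReal, dotProduct]

theorem ContinuousLinearMap.re_inner_ofReal [DecidableEq ι]
    (P : EuclideanSpace ℂ ι →L[ℂ] EuclideanSpace ℂ ι) (x y : ι → ℝ) :
    (⟪P (EuclideanSpace.ofReal x), EuclideanSpace.ofReal y⟫_ℂ).re = (P.reMatrix *ᵥ x) ⬝ᵥ y := by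
  have hx : EuclideanSpace.ofReal x = ∑ j, (x j : ℂ) • EuclideanSpace.single j (1 : ℂ) := by
    ext i
    simp [EuclideanSpace.ofReal, Pi.single_apply]
  rw [EuclideanSpace.re_inner_eq]
  have h1 : (fun i => (P (EuclideanSpace.ofReal x) i).re) = P.reMatrix *ᵥ x := by
    ext i
    rw [hx]
    simp [reMatrix, mulVec, dotProduct, mul_comm]
  rw [h1]
  simp [EuclideanSpace.ofReal, dotProduct]

theorem ContinuousLinearMap.isSymm_reMatrix [DecidableEq ι]
    {P : EuclideanSpace ℂ ι →L[ℂ] EuclideanSpace ℂ ι} (hP : IsSelfAdjoint P) :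
    P.reMatrix.IsSymm := by
  refine Matrix.IsSymm.ext fun i j => ?_
  have h : ∀ i j, P.reMatrix i j
      = (⟪P (EuclideanSpace.single j 1), EuclideanSpace.single i (1 : ℂ)⟫_ℂ).re := fun i j => by
    simp [reMatrix, EuclideanSpace.inner_single_right]
  rw [h, h, ← inner_conj_symm, Complex.conj_re]
  exact congrArg Complex.re (hP.isSymmetric _ _).symm

end

/-- Lemma 1 (bounded real lemma): under PBH observability, asymptotic stability
together with the H∞ norm bound `‖C_c (sI − A_c)⁻¹ B‖∞ ≤ γ` is equivalent to the
existence of a symmetric positive definite solution of the Riccati inequality. -/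
theorem lemma1 {n q p : ℕ} (γ : ℝ) (hγ : 0 < γ)
    (Ac : Matrix (Fin n) (Fin n) ℝ) (B : Matrix (Fin n) (Fin q) ℝ)
    (Cc : Matrix (Fin p) (Fin n) ℝ)
    (hobs : PBHObservable Cc Ac) :
    (IsHurwitz Ac ∧
      ∀ ω : ℝ,
        IsUnit ((Complex.I * (ω : ℂ)) • (1 : Matrix (Fin n) (Fin n) ℂ)
          - Ac.map (algebraMap ℝ ℂ)) ∧
        ∀ v : Fin q → ℂ,
          euclNorm ((Cc.map (algebraMap ℝ ℂ)
              * ((Complex.I * (ω : ℂ)) • (1 : Matrix (Fin n) (Fin n) ℂ)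
                  - Ac.map (algebraMap ℝ ℂ))⁻¹
              * B.map (algebraMap ℝ ℂ)) *ᵥ v)
            ≤ γ * euclNorm v) ↔
    (∃ P : Matrix (Fin n) (Fin n) ℝ, P.IsSymm ∧ P.PosDef ∧
      (-(Acᵀ * P + P * Ac + (γ ^ 2)⁻¹ • (P * B * Bᵀ * P) + Ccᵀ * Cc)).PosSemidef) := by
  constructor
  · rintro ⟨hH, hω⟩
    have hA := (isHurwitz_iff_stableOp Ac).1 hH
    obtain ⟨P, hP⟩ := FreqBound.exists_isStorage hγ hA
      ((freqBound_iff fun ω => (hω ω).1).2 fun ω => (hω ω).2)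
    have hsymm := ContinuousLinearMap.isSymm_reMatrix hP.1
    refine ⟨P.reMatrix, hsymm, ?_, ?_⟩
    · refine posDef_iff_dotProduct_mulVec.2 ⟨?_, fun {x} hx => ?_⟩
      · rw [IsHermitian, conjTranspose_eq_transpose_of_trivial, hsymm.eq]
      · rw [star_trivial, dotProduct_comm, ← P.re_inner_ofReal]
        refine hP.re_inner_pos hA hobs.complexMap_ne_zero fun h0 => hx (funext fun i => ?_)
        exact Complex.ofReal_injective (congrFun (congrArg WithLp.ofLp h0) i)
    · refine (posSemidef_neg_riccati_iff hγ _ _ _ _ hsymm).2 fun x u => ?_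
      have h := hP.2 (EuclideanSpace.ofReal x) (EuclideanSpace.ofReal u)
      rwa [inner_add_right, Complex.add_re, complexMap_ofReal, complexMap_ofReal,
        complexMap_ofReal, P.re_inner_ofReal, P.re_inner_ofReal, EuclideanSpace.norm_sq_ofReal,
        EuclideanSpace.norm_sq_ofReal, ← dotProduct_add] at h
  · rintro ⟨P, hsymm, hpos, hR⟩
    have hP := isStorage_complexMap hsymm ((posSemidef_neg_riccati_iff hγ _ _ _ _ hsymm).1 hR)
    have hpos' : ∀ x, x ≠ 0 → 0 < (⟪P.complexMap x, x⟫_ℂ).re := fun x hx => by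
      have hnn : ∀ v, 0 ≤ (P *ᵥ v) ⬝ᵥ v := fun v => by
        simpa [dotProduct_comm] using hpos.posSemidef.dotProduct_mulVec_nonneg v
      have hp : ∀ v, v ≠ 0 → 0 < (P *ᵥ v) ⬝ᵥ v := fun v hv => by
        simpa [dotProduct_comm] using hpos.dotProduct_mulVec_pos hv
      rw [EuclideanSpace.re_inner_eq, re_complexMap, im_complexMap]
      by_cases hre : (fun i => (x i).re) = 0
      · refine add_pos_of_nonneg_of_pos (hnn _) (hp _ fun him => hx ?_)
        ext i
        exact Complex.ext (congrFun hre i) (congrFun him i)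
      · exact add_pos_of_pos_of_nonneg (hp _ hre) (hnn _)
    have hH := (isHurwitz_iff_stableOp Ac).2 (hP.stableOp hpos' hobs.complexMap_ne_zero)
    exact ⟨hH, fun ω => ⟨hH.isUnit ω, (freqBound_iff hH.isUnit).1 (hP.freqBound hγ) ω⟩⟩
end

section
/- Let A_c be a real n×n matrix, B a real n×q matrix, C_c a real p×n matrix, γ > 0, and let P be a real symmetric n×n matrix satisfying the Riccati inequality A_cᵀ·P + P·A_c + γ⁻²·P·B·Bᵀ·P + C_cᵀ·C_c ⪯ 0 (negative semidefinite). Then for every ω ∈ ℝ such that the complex matrix (iω)·I − A_c is invertible, and for every v ∈ ℂ^q, ‖C_c·((iω)·I − A_c)⁻¹·B·v‖ ≤ γ·‖v‖ in the Euclidean norm. -/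
open Matrix

theorem euclNorm_sq {ι : Type*} [Fintype ι] (x : ι → ℂ) :
    euclNorm x ^ 2 = (fun i => (x i).re) ⬝ᵥ (fun i => (x i).re)
      + (fun i => (x i).im) ⬝ᵥ (fun i => (x i).im) := by
  simp [euclNorm, EuclideanSpace.norm_sq_eq, dotProduct, ← Finset.sum_add_distrib,
    ← Complex.normSq_eq_norm_sq, Complex.normSq_apply]

theorem euclNorm_nonneg {ι : Type*} [Fintype ι] (x : ι → ℂ) : 0 ≤ euclNorm x :=
  norm_nonneg _

theorem re_map_mulVec {ι κ : Type*} [Fintype κ] (M : Matrix ι κ ℝ) (x : κ → ℂ) :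
    (fun i => ((M.map (algebraMap ℝ ℂ) *ᵥ x) i).re) = M *ᵥ fun i => (x i).re := by
  ext i
  simp [mulVec, dotProduct]

theorem im_map_mulVec {ι κ : Type*} [Fintype κ] (M : Matrix ι κ ℝ) (x : κ → ℂ) :
    (fun i => ((M.map (algebraMap ℝ ℂ) *ᵥ x) i).im) = M *ᵥ fun i => (x i).im := by
  ext i
  simp [mulVec, dotProduct]

/-- The Riccati inequality evaluated at a real state vector, after completing the square in the
input `c`. -/
theorem riccati_dissipation {n q p : Type*} [Fintype n] [Fintype q] [Fintype p]
    (A : Matrix n n ℝ) (B : Matrix n q ℝ) (C : Matrix p n ℝ) (γ : ℝ) (hγ : 0 < γ)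
    (P : Matrix n n ℝ) (hP : P.IsSymm)
    (hRic : (-(Aᵀ * P + P * A + (γ ^ 2)⁻¹ • (P * B * Bᵀ * P) + Cᵀ * C)).PosSemidef)
    (a : n → ℝ) (c : q → ℝ) :
    (C *ᵥ a) ⬝ᵥ (C *ᵥ a) + 2 * ((P *ᵥ a) ⬝ᵥ (A *ᵥ a + B *ᵥ c)) ≤ γ ^ 2 * (c ⬝ᵥ c) := by
  have h := hRic.dotProduct_mulVec_nonneg a
  have hPt : ∀ x y : n → ℝ, x ⬝ᵥ (P *ᵥ y) = (P *ᵥ x) ⬝ᵥ y := fun x y => by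
    rw [dotProduct_mulVec, ← mulVec_transpose, hP.eq]
  simp only [star_trivial, neg_mulVec, add_mulVec, smul_mulVec, ← mulVec_mulVec, dotProduct_neg,
    dotProduct_add, dotProduct_smul, smul_eq_mul, hPt] at h
  rw [dotProduct_mulVec a Aᵀ, vecMul_transpose, dotProduct_mulVec a Cᵀ, vecMul_transpose,
    dotProduct_comm (A *ᵥ a), dotProduct_mulVec (P *ᵥ a) B, ← mulVec_transpose] at h
  have hsq := dotProduct_self_star_nonneg (γ⁻¹ • (Bᵀ *ᵥ (P *ᵥ a)) - γ • c)
  simp only [star_trivial, sub_dotProduct, dotProduct_sub, smul_dotProduct, dotProduct_smul,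
    smul_eq_mul] at hsq
  rw [dotProduct_comm c, mul_sub, mul_sub, mul_inv_cancel_left₀ hγ.ne',
    inv_mul_cancel_left₀ hγ.ne'] at hsq
  rw [dotProduct_add, dotProduct_mulVec (P *ᵥ a) B, ← mulVec_transpose]
  rw [← inv_pow] at h
  linarith

/-- A symmetric solution of the Riccati inequality certifies the H∞ norm bound
`‖C_c (sI − A_c)⁻¹ B‖∞ ≤ γ` at every purely imaginary point `s = iω` where the
resolvent exists. -/
theorem riccati_frequency_bound {n q p : ℕ}
    (Ac : Matrix (Fin n) (Fin n) ℝ) (B : Matrix (Fin n) (Fin q) ℝ)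
    (Cc : Matrix (Fin p) (Fin n) ℝ) (γ : ℝ) (hγ : 0 < γ)
    (P : Matrix (Fin n) (Fin n) ℝ) (hPsym : P.IsSymm)
    (hRic : (-(Acᵀ * P + P * Ac + (γ ^ 2)⁻¹ • (P * B * Bᵀ * P) + Ccᵀ * Cc)).PosSemidef) :
    ∀ ω : ℝ,
      IsUnit ((Complex.I * (ω : ℂ)) • (1 : Matrix (Fin n) (Fin n) ℂ)
        - Ac.map (algebraMap ℝ ℂ)) →
      ∀ v : Fin q → ℂ,
        euclNorm ((Cc.map (algebraMap ℝ ℂ)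
            * ((Complex.I * (ω : ℂ)) • (1 : Matrix (Fin n) (Fin n) ℂ)
                - Ac.map (algebraMap ℝ ℂ))⁻¹
            * B.map (algebraMap ℝ ℂ)) *ᵥ v)
          ≤ γ * euclNorm v := by
  intro ω hu v
  set R := (Complex.I * (ω : ℂ)) • (1 : Matrix (Fin n) (Fin n) ℂ) - Ac.map (algebraMap ℝ ℂ)
    with hR
  set x := R⁻¹ *ᵥ (B.map (algebraMap ℝ ℂ) *ᵥ v) with hx
  have hRx : (Complex.I * (ω : ℂ)) • x
      = Ac.map (algebraMap ℝ ℂ) *ᵥ x + B.map (algebraMap ℝ ℂ) *ᵥ v := by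
    have h : R *ᵥ x = B.map (algebraMap ℝ ℂ) *ᵥ v := by
      rw [hx, mulVec_mulVec, mul_nonsing_inv R ((isUnit_iff_isUnit_det R).mp hu), one_mulVec]
    rw [← h, hR, sub_mulVec, smul_mulVec, one_mulVec, add_sub_cancel]
  rw [← mulVec_mulVec, ← mulVec_mulVec, ← hx]
  have hre : Ac *ᵥ (fun i => (x i).re) + B *ᵥ (fun i => (v i).re)
      = -ω • fun i => (x i).im := by
    rw [← re_map_mulVec, ← re_map_mulVec]
    ext i
    simpa using (congrArg Complex.re (congrFun hRx i)).symm
  have him : Ac *ᵥ (fun i => (x i).im) + B *ᵥ (fun i => (v i).im)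
      = ω • fun i => (x i).re := by
    rw [← im_map_mulVec, ← im_map_mulVec]
    ext i
    simpa using (congrArg Complex.im (congrFun hRx i)).symm
  have h₁ := riccati_dissipation Ac B Cc γ hγ P hPsym hRic (fun i => (x i).re) fun i => (v i).re
  have h₂ := riccati_dissipation Ac B Cc γ hγ P hPsym hRic (fun i => (x i).im) fun i => (v i).im
  have hcross : (P *ᵥ fun i => (x i).im) ⬝ᵥ (fun i => (x i).re)
      = (P *ᵥ fun i => (x i).re) ⬝ᵥ fun i => (x i).im := by
    rw [dotProduct_comm, dotProduct_mulVec, ← mulVec_transpose, hPsym.eq]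
  rw [hre, dotProduct_smul, smul_eq_mul] at h₁
  rw [him, dotProduct_smul, smul_eq_mul, hcross] at h₂
  refine (sq_le_sq₀ (euclNorm_nonneg _) (mul_nonneg hγ.le (euclNorm_nonneg v))).mp ?_
  rw [mul_pow, euclNorm_sq, euclNorm_sq, re_map_mulVec, im_map_mulVec]
  linarith
end
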